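/- Correctness of S2PHP: Let a, b ∈ ℝ^n and ρ ≥ 2. For each i ∈ {1, …, n}, let α_i ∈ ℝ^ρ satisfy Σ_{j=1}^{ρ} α_i^{(j)} = a_i and let β_i ∈ ℝ^ρ satisfy Σ_{j=1}^{ρ} β_i^{(j)} = b_i; let α_i^* ∈ ℝ^{ρ²} consist of ρ consecutive copies of α_i, and let β_i^* ∈ ℝ^{ρ²} be the vector whose entry in position (k−1)ρ + j equals β_i^{(σ_{i,j}(k))} for permutations σ_{i,1}, …, σ_{i,ρ} of {1, …, ρ}. Let A ∈ ℝ^{n×ρ²} have rows (α_i^*)^T and B ∈ ℝ^{ρ²×n} have columns β_i^*. If V_a, V_b ∈ ℝ^{n×n} satisfy V_a + V_b = A × B, then the vectors v_a and v_b of main-diagonal entries of V_a and V_b satisfy v_a + v_b = a ⊙ b, where ⊙ denotes the elementwise (Hadamard) product. -/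

import Mathlib

/-- Correctness of the S2PHP (secure 2-party vector hadamard product)
protocol: if `V_a + V_b = A × B` for the matrices built from the additive
splits of `a` and `b` (repeated copies on Alice's side, permuted copies on
Bob's side, with `ℝ^(ρ²)` indexed by pairs `(k, j) ∈ Fin ρ × Fin ρ`
corresponding to position `(k-1)ρ + j`), then the main diagonals of `V_a` and
`V_b` are additive shares of the Hadamard product `a ⊙ b`. -/
theorem s2php_correct {n ρ : ℕ} (hρ : 2 ≤ ρ)
    (a b : Fin n → ℝ)
    (α β : Fin n → Fin ρ → ℝ)
    (hα : ∀ i, ∑ j : Fin ρ, α i j = a i)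
    (hβ : ∀ i, ∑ j : Fin ρ, β i j = b i)
    (σ : Fin n → Fin ρ → Equiv.Perm (Fin ρ))
    (A : Matrix (Fin n) (Fin ρ × Fin ρ) ℝ)
    (hA : ∀ i k j, A i (k, j) = α i j)
    (B : Matrix (Fin ρ × Fin ρ) (Fin n) ℝ)
    (hB : ∀ k j i, B (k, j) i = β i (σ i j k))
    (Va Vb : Matrix (Fin n) (Fin n) ℝ)
    (hV : Va + Vb = A * B)
    (va vb : Fin n → ℝ)
    (hva : va = fun i => Va i i) (hvb : vb = fun i => Vb i i) :
    va + vb = a * b := by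
  subst hva hvb
  funext i
  calc Va i i + Vb i i = (A * B) i i := congrFun (congrFun hV i) i
    _ = ∑ j, ∑ k, α i j * β i (σ i j k) := by
      simp only [Matrix.mul_apply, Fintype.sum_prod_type_right, hA, hB]
    _ = ∑ j, α i j * b i := by
      simp only [← Finset.mul_sum, Equiv.sum_comp (σ i _) (β i), hβ]
    _ = a i * b i := by rw [← Finset.sum_mul, hα]
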